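/- arXiv:0905.4225 — 2 statements merged into one kernel-verified Lean document; each statement's English description precedes it below -/
import Mathlib

section
/- Let λ be a real with 0 < λ < 1 and let a ≤ m ≤ b be natural numbers with b·λ < 1. Then for every natural number n ≥ 1: C(m,n)·λⁿ·(1−λ)^{m−n} ≤ C(b,n)·λⁿ·(1−λ)^{b−n}, where C(m,n) denotes the binomial coefficient and the left-hand side is interpreted as 0 when n > m. Moreover, for n = 0: (1−λ)^{m} ≤ (1−λ)^{a}. -/
/-- If `(m + 1) * x ≤ 1`, then `x` is at most the ratio `C(m, k) / C(m + 1, k + 1)`. -/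
theorem mul_choose_succ_succ_le_choose {x : ℝ} {m : ℕ} (hx : ((m + 1 : ℕ) : ℝ) * x ≤ 1) (k : ℕ) :
    x * ((m + 1).choose (k + 1) : ℝ) ≤ (m.choose k : ℝ) := by
  have hid : ((m : ℝ) + 1) * (m.choose k : ℝ) = ((m + 1).choose (k + 1) : ℝ) * ((k : ℝ) + 1) := by
    exact_mod_cast Nat.add_one_mul_choose_eq m k
  have hc : (0 : ℝ) ≤ ((m + 1).choose (k + 1) : ℝ) := Nat.cast_nonneg _
  push_cast at hx
  refine le_of_mul_le_mul_left ?_ (by positivity : (0 : ℝ) < (m : ℝ) + 1)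
  calc ((m : ℝ) + 1) * (x * ((m + 1).choose (k + 1) : ℝ))
      = (((m : ℝ) + 1) * x) * ((m + 1).choose (k + 1) : ℝ) := by ring
    _ ≤ 1 * ((m + 1).choose (k + 1) : ℝ) := by gcongr
    _ ≤ ((k : ℝ) + 1) * ((m + 1).choose (k + 1) : ℝ) := by
        gcongr
        exact le_add_of_nonneg_left k.cast_nonneg
    _ = ((m : ℝ) + 1) * (m.choose k : ℝ) := by rw [hid, mul_comm]

/-- For positive `n`, the binomial probability of `n` successes in `m` trials does not decrease
when a trial is added, as long as the expected number of successes stays at most one. -/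
theorem binomial_prob_le_succ {x : ℝ} (hx0 : 0 ≤ x) (hx1 : x ≤ 1) {m n : ℕ} (hn : 1 ≤ n)
    (hx : ((m + 1 : ℕ) : ℝ) * x ≤ 1) :
    (m.choose n : ℝ) * x ^ n * (1 - x) ^ (m - n) ≤
      ((m + 1).choose n : ℝ) * x ^ n * (1 - x) ^ (m + 1 - n) := by
  have hx1' : 0 ≤ 1 - x := sub_nonneg.2 hx1
  obtain hmn | hnm := lt_or_ge m n
  · rw [Nat.choose_eq_zero_of_lt hmn]
    simp only [Nat.cast_zero, zero_mul]
    positivity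
  obtain ⟨k, rfl⟩ := Nat.exists_eq_add_of_le' hn
  have hpascal : ((m + 1).choose (k + 1) : ℝ) = m.choose k + m.choose (k + 1) := by
    exact_mod_cast Nat.choose_succ_succ m k
  have hstep : (m.choose (k + 1) : ℝ) ≤ ((m + 1).choose (k + 1) : ℝ) * (1 - x) := by
    linarith [mul_choose_succ_succ_le_choose hx k]
  rw [Nat.sub_add_comm hnm, pow_succ]
  calc (m.choose (k + 1) : ℝ) * x ^ (k + 1) * (1 - x) ^ (m - (k + 1))
      ≤ ((m + 1).choose (k + 1) : ℝ) * (1 - x) * x ^ (k + 1) * (1 - x) ^ (m - (k + 1)) := by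
        gcongr
    _ = _ := by ring


/-- Upper bound of Eq. (B.4): for `0 < λ < 1`, naturals `a ≤ m ≤ b` with `b·λ < 1`
(Condition 1), the Bernoulli-thinning output probability `C(m,n) λⁿ (1-λ)^(m-n)` is, for
every `n ≥ 1`, at most its value at the endpoint `b` (the left side being `0` when
`n > m` since `C(m,n) = 0`); and for `n = 0`, `(1-λ)^m ≤ (1-λ)^a`. -/
theorem output_photon_prob_upper (lam : ℝ) (hl0 : 0 < lam) (hl1 : lam < 1)
    (a m b : ℕ) (ham : a ≤ m) (hmb : m ≤ b) (hbl : (b : ℝ) * lam < 1) :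
    (∀ n : ℕ, 1 ≤ n →
      (m.choose n : ℝ) * lam ^ n * (1 - lam) ^ (m - n) ≤
        (b.choose n : ℝ) * lam ^ n * (1 - lam) ^ (b - n)) ∧
    (1 - lam) ^ m ≤ (1 - lam) ^ a := by
  refine ⟨fun n hn => ?_, pow_le_pow_of_le_one (by linarith) (by linarith) ham⟩
  induction b, hmb using Nat.le_induction with
  | base => exact le_rfl
  | succ b _ ih =>
    refine (ih ?_).trans (binomial_prob_le_succ hl0.le hl1.le hn hbl.le)
    push_cast at hbl
    linarith
end

section
/- Let λ be a real with 0 < λ < 1 and let a ≤ m ≤ b be natural numbers with b·λ < 1. Then for every natural number n with 1 ≤ n ≤ a: C(m,n)·λⁿ·(1−λ)^{m−n} ≥ C(a,n)·λⁿ·(1−λ)^{a−n}, where C(m,n) denotes the binomial coefficient. Moreover, for n = 0: (1−λ)^{m} ≥ (1−λ)^{b}. -/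
/-- Adding one trial does not decrease the probability of `n` successes as long as the expected
number of successes stays at most `n`. -/
theorem binomial_prob_le_succ_s12 {p : ℝ} (hp0 : 0 ≤ p) (hp1 : p ≤ 1) {k n : ℕ} (hnk : n ≤ k)
    (h : ((k : ℝ) + 1) * p ≤ n) :
    (k.choose n : ℝ) * p ^ n * (1 - p) ^ (k - n) ≤
      ((k + 1).choose n : ℝ) * p ^ n * (1 - p) ^ (k + 1 - n) := by
  have hrec : (k.choose n : ℝ) * (k + 1) = (k + 1).choose n * (k + 1 - n) := by
    have := congrArg (Nat.cast (R := ℝ)) (Nat.choose_mul_succ_eq k n)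
    rw [Nat.cast_mul, Nat.cast_mul, Nat.cast_sub (by omega)] at this
    exact_mod_cast this
  have hchoose : (k.choose n : ℝ) ≤ (k + 1).choose n * (1 - p) := by
    refine le_of_mul_le_mul_right ?_ (by positivity : (0 : ℝ) < k + 1)
    rw [hrec, mul_assoc]
    gcongr
    linarith
  have hq : 0 ≤ 1 - p := by linarith
  calc (k.choose n : ℝ) * p ^ n * (1 - p) ^ (k - n)
      ≤ ((k + 1).choose n * (1 - p)) * p ^ n * (1 - p) ^ (k - n) := by gcongr
    _ = _ := by rw [Nat.succ_sub hnk, pow_succ]; ring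

/-- Lower bound of Eq. (B.4): for `0 < λ < 1`, naturals `a ≤ m ≤ b` with `b·λ < 1`
(Condition 1), the Bernoulli-thinning output probability `C(m,n) λⁿ (1-λ)^(m-n)` is, for
every `1 ≤ n ≤ a`, at least its value at the endpoint `a`; and for `n = 0`,
`(1-λ)^m ≥ (1-λ)^b`. -/
theorem output_photon_prob_lower (lam : ℝ) (hl0 : 0 < lam) (hl1 : lam < 1)
    (a m b : ℕ) (ham : a ≤ m) (hmb : m ≤ b) (hbl : (b : ℝ) * lam < 1) :
    (∀ n : ℕ, 1 ≤ n → n ≤ a →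
      (m.choose n : ℝ) * lam ^ n * (1 - lam) ^ (m - n) ≥
        (a.choose n : ℝ) * lam ^ n * (1 - lam) ^ (a - n)) ∧
    (1 - lam) ^ m ≥ (1 - lam) ^ b := by
  refine ⟨fun n hn hna => ?_, pow_le_pow_of_le_one (by linarith) (by linarith) hmb⟩
  induction m, ham using Nat.le_induction with
  | base => exact le_refl _
  | succ k hak ih =>
    refine ge_trans (binomial_prob_le_succ_s12 hl0.le hl1.le (hna.trans hak) ?_) (ih (by omega))
    have hkb : ((k + 1 : ℕ) : ℝ) * lam ≤ b * lam := by gcongr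
    have hn' : (1 : ℝ) ≤ n := by exact_mod_cast hn
    push_cast at hkb
    linarith
end
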